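/- arXiv:1701.09181 — 2 statements merged into one kernel-verified Lean document; each statement's English description precedes it below -/
import Mathlib

section
/- For every constant c ≥ 1 there exist constants H₀ ≥ 1 and C > 0 with the following property: whenever H ≥ H₀ and A > 0 satisfy 1/c ≤ (1/2)·sinh(A)·|1 − sinh(A)²/sinh(H)²| ≤ c, then either sinh(A) ≤ 4c, or both |A − H| ≤ C·e^{−H} and |4π·sinh(A)² − 4π·sinh(H)²| ≤ C·e^{H} hold; in the latter case in particular e^{−2H}·4π·sinh(A)² ∈ [C^{−1}, C]. -/
open Real

theorem sub_mul_sinh_le_sinh_sub_sinh {x y : ℝ} (hx : 0 ≤ x) (hxy : x ≤ y) :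
    (y - x) * Real.sinh x ≤ Real.sinh y - Real.sinh x := by
  have hadd : Real.sinh y =
      Real.sinh x * Real.cosh (y - x) + Real.cosh x * Real.sinh (y - x) := by
    rw [← Real.sinh_add, add_sub_cancel]
  have hd : 0 ≤ y - x := sub_nonneg.2 hxy
  have hsinh : 0 ≤ Real.sinh x := Real.sinh_nonneg_iff.2 hx
  have hcosh : Real.sinh x ≤ Real.cosh x := (Real.sinh_lt_cosh x).le
  have h₁ : Real.sinh x * 1 ≤ Real.sinh x * Real.cosh (y - x) :=
    mul_le_mul_of_nonneg_left (Real.one_le_cosh _) hsinh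
  have h₂ : Real.sinh x * (y - x) ≤ Real.cosh x * Real.sinh (y - x) :=
    mul_le_mul hcosh (Real.self_le_sinh_iff.2 hd) hd (hsinh.trans hcosh)
  linarith

theorem abs_sub_mul_le_abs_sinh_sub_sinh {x y m : ℝ} (hx : 0 ≤ x) (hy : 0 ≤ y)
    (hmx : m ≤ Real.sinh x) (hmy : m ≤ Real.sinh y) :
    |x - y| * m ≤ |Real.sinh x - Real.sinh y| := by
  wlog hxy : y ≤ x generalizing x y
  · rw [abs_sub_comm x, abs_sub_comm (Real.sinh x)]
    exact this hy hx hmy hmx (le_of_not_ge hxy)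
  rw [abs_of_nonneg (sub_nonneg.2 hxy), abs_of_nonneg (sub_nonneg.2 (Real.sinh_le_sinh.2 hxy))]
  exact (mul_le_mul_of_nonneg_left hmy (sub_nonneg.2 hxy)).trans
    (sub_mul_sinh_le_sinh_sub_sinh hy hxy)

theorem exp_le_four_mul_sinh {x : ℝ} (hx : 1 ≤ x) : Real.exp x ≤ 4 * Real.sinh x := by
  have h₁ : 2 ≤ Real.exp x := by linarith [Real.add_one_le_exp x]
  have h₂ : Real.exp (-x) ≤ 1 := Real.exp_le_one_iff.2 (by linarith)
  rw [Real.sinh_eq]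
  linarith

theorem two_mul_sinh_le_exp (x : ℝ) : 2 * Real.sinh x ≤ Real.exp x := by
  rw [Real.sinh_eq]
  linarith [Real.exp_pos (-x)]

/-- An upper bound on the mass of a large sphere makes `s` comparable to `t`. -/
theorem sq_bounds_of_mass_le {c s t : ℝ} (hs : 0 < s) (ht : 0 < t) (hcs : 4 * c < s)
    (hm : (1 / 2) * s * |1 - s ^ 2 / t ^ 2| ≤ c) :
    t ^ 2 ≤ 2 * s ^ 2 ∧ 2 * s ^ 2 ≤ 3 * t ^ 2 ∧ s * |s ^ 2 - t ^ 2| ≤ 2 * c * t ^ 2 := by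
  have ht2 : 0 < t ^ 2 := by positivity
  have heq : |1 - s ^ 2 / t ^ 2| * t ^ 2 = |s ^ 2 - t ^ 2| := by
    rw [abs_sub_comm (s ^ 2), ← abs_of_pos ht2, ← abs_mul, abs_of_pos ht2]
    congr 1
    field_simp
  have hdiff : s * |s ^ 2 - t ^ 2| ≤ 2 * c * t ^ 2 := by
    rw [← heq]
    nlinarith
  have hhalf : 2 * |s ^ 2 - t ^ 2| ≤ t ^ 2 := by
    refine le_of_mul_le_mul_left ?_ hs
    nlinarith
  obtain ⟨h₁, h₂⟩ := abs_le.1 (show |s ^ 2 - t ^ 2| ≤ t ^ 2 / 2 by linarith)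
  exact ⟨by linarith, by linarith, hdiff⟩

/-- Quantitative content of the lemma "boundedness of the Hawking mass implies
boundedness of the area": if the hyperbolic Hawking mass
`(1/2)·sinh A·|1 − sinh A²/sinh H²|` lies in `[1/c, c]`, then either the area is
bounded (`sinh A ≤ 4c`) or `|A − H| ≤ C·e^{−H}` and
`|4π sinh A² − 4π sinh H²| ≤ C·e^{H}`, and in particular
`e^{−2H}·4π·sinh A² ∈ [C⁻¹, C]`. -/
theorem hawking_mass_bounded_implies_area_bounded :
    ∀ c : ℝ, 1 ≤ c → ∃ H₀ C : ℝ, 1 ≤ H₀ ∧ 0 < C ∧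
      ∀ H A : ℝ, H₀ ≤ H → 0 < A →
        1 / c ≤ (1 / 2) * Real.sinh A * |1 - Real.sinh A ^ 2 / Real.sinh H ^ 2| →
        (1 / 2) * Real.sinh A * |1 - Real.sinh A ^ 2 / Real.sinh H ^ 2| ≤ c →
        Real.sinh A ≤ 4 * c ∨
          (|A - H| ≤ C * Real.exp (-H) ∧
           |4 * π * Real.sinh A ^ 2 - 4 * π * Real.sinh H ^ 2| ≤ C * Real.exp H ∧
           Real.exp (-2 * H) * (4 * π * Real.sinh A ^ 2) ∈ Set.Icc C⁻¹ C) := by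
  intro c hc
  refine ⟨1, 40 * c, le_rfl, by linarith, fun H A hH hA _ hm => ?_⟩
  refine or_iff_not_imp_left.2 fun hlarge => ?_
  have hs : 0 < Real.sinh A := Real.sinh_pos_iff.2 hA
  have ht : 0 < Real.sinh H := Real.sinh_pos_iff.2 (by linarith)
  obtain ⟨hlow, hup, hdiff⟩ := sq_bounds_of_mass_le hs ht (not_le.1 hlarge) hm
  have hinv : |A - H| * (Real.sinh H / 2) ≤ |Real.sinh A - Real.sinh H| := by
    refine abs_sub_mul_le_abs_sinh_sub_sinh hA.le (by linarith) ?_ (by linarith)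
    nlinarith
  have hEup := exp_le_four_mul_sinh hH
  have hElow := two_mul_sinh_le_exp H
  have hE : 0 < Real.exp H := Real.exp_pos H
  have hexp2 : Real.exp (-2 * H) = (Real.exp H ^ 2)⁻¹ := by
    rw [← Real.exp_nat_mul, ← Real.exp_neg]
    congr 1
    push_cast
    ring
  rw [hexp2, Real.exp_neg]
  generalize Real.exp H = e at *
  generalize Real.sinh A = s at *
  generalize Real.sinh H = t at *
  have hts : t ≤ 2 * s := by nlinarith
  have hsq : |s ^ 2 - t ^ 2| ≤ 4 * c * t := by
    refine le_of_mul_le_mul_left (hdiff.trans ?_) hs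
    nlinarith [mul_le_mul_of_nonneg_left hts (by positivity : 0 ≤ 2 * c * t)]
  have hst : |s - t| ≤ 4 * c := by
    have hfac : |s ^ 2 - t ^ 2| = |s - t| * (s + t) := by
      rw [sq_sub_sq, abs_mul, abs_of_pos (by linarith : 0 < s + t), mul_comm]
    refine le_of_mul_le_mul_right ?_ ht
    nlinarith [mul_nonneg (abs_nonneg (s - t)) hs.le]
  have hpi := Real.pi_gt_three
  have hpi' := Real.pi_lt_four
  have he2 : 0 < e ^ 2 := by positivity
  have hlow2 : e ^ 2 ≤ 16 * t ^ 2 := by nlinarith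
  have hup2 : 4 * t ^ 2 ≤ e ^ 2 := by nlinarith
  refine ⟨?_, ?_, ?_, ?_⟩
  · rw [← div_eq_mul_inv, le_div_iff₀ hE]
    nlinarith [mul_le_mul_of_nonneg_left hEup (abs_nonneg (A - H))]
  · rw [← mul_sub, abs_mul, abs_of_pos (by positivity : 0 < 4 * π)]
    calc 4 * π * |s ^ 2 - t ^ 2| ≤ 4 * 4 * (4 * c * t) := by gcongr
      _ ≤ 40 * c * e := by nlinarith [mul_le_mul_of_nonneg_left hElow (by positivity : 0 ≤ c)]
  · rw [inv_mul_eq_div, le_div_iff₀ he2]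
    calc (40 * c)⁻¹ * e ^ 2 ≤ (1 / 40) * e ^ 2 := by
          gcongr
          rw [one_div]
          gcongr
          linarith
      _ ≤ 4 * 3 * s ^ 2 := by nlinarith
      _ ≤ 4 * π * s ^ 2 := by gcongr
  · rw [inv_mul_eq_div, div_le_iff₀ he2]
    calc 4 * π * s ^ 2 ≤ 4 * 4 * s ^ 2 := by gcongr
      _ ≤ 40 * 1 * e ^ 2 := by nlinarith
      _ ≤ 40 * c * e ^ 2 := by gcongr
end

section
/- Let b > 2, δ ≥ 0 and 0 < H₀ ≤ ς. If w : [H₀, ς] → ℝ is differentiable with w(ς) = 0 and |w′(H) + 2·(cosh(H)/sinh(H))·w(H)| ≤ δ·e^{−bH} for all H ∈ [H₀, ς], then |w(H)| ≤ (δ/(4·(b − 2)))·e^{(2−b)H}/sinh(H)² for all H ∈ [H₀, ς]; in particular |w(H)| ≤ C(H₀)·δ·e^{−bH} for a constant C(H₀) depending only on H₀. -/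
open Real

/-- If `|f'| ≤ -g'` on `[a, b]`, `f b = 0` and `0 ≤ g b`, then `|f| ≤ g` on `[a, b]`. -/
theorem abs_le_of_abs_hasDerivAt_le_neg {f f' g g' : ℝ → ℝ} {a b : ℝ}
    (hf : ∀ x ∈ Set.Icc a b, HasDerivAt f (f' x) x)
    (hg : ∀ x ∈ Set.Icc a b, HasDerivAt g (g' x) x)
    (hfg : ∀ x ∈ Set.Icc a b, |f' x| ≤ -g' x) (hfb : f b = 0) (hgb : 0 ≤ g b)
    {x : ℝ} (hx : x ∈ Set.Icc a b) : |f x| ≤ g x := by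
  have hb : b ∈ Set.Icc a b := ⟨hx.1.trans hx.2, le_rfl⟩
  have hadd : AntitoneOn (fun y => g y + f y) (Set.Icc a b) :=
    antitoneOn_of_hasDerivWithinAt_nonpos (convex_Icc a b)
      (fun y hy => ((hg y hy).add (hf y hy)).continuousAt.continuousWithinAt)
      (fun y hy => ((hg y (interior_subset hy)).add (hf y (interior_subset hy))).hasDerivWithinAt)
      (fun y hy => by linarith [(abs_le.1 (hfg y (interior_subset hy))).2])
  have hsub : AntitoneOn (fun y => g y - f y) (Set.Icc a b) :=
    antitoneOn_of_hasDerivWithinAt_nonpos (convex_Icc a b)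
      (fun y hy => ((hg y hy).sub (hf y hy)).continuousAt.continuousWithinAt)
      (fun y hy => ((hg y (interior_subset hy)).sub (hf y (interior_subset hy))).hasDerivWithinAt)
      (fun y hy => by linarith [(abs_le.1 (hfg y (interior_subset hy))).1])
  have h₁ : g b + f b ≤ g x + f x := hadd hx hb hx.2
  have h₂ : g b - f b ≤ g x - f x := hsub hx hb hx.2
  exact abs_le.2 ⟨by linarith, by linarith⟩

theorem sinh_sq_le_exp_two_mul_div_four {x : ℝ} (hx : 0 ≤ x) :
    sinh x ^ 2 ≤ exp (2 * x) / 4 := by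
  have h : sinh x ≤ exp x / 2 := by
    rw [sinh_eq]
    linarith [exp_pos (-x)]
  calc sinh x ^ 2 ≤ (exp x / 2) ^ 2 := by gcongr
    _ = exp (2 * x) / 4 := by rw [div_pow, ← exp_nat_mul]; norm_num

theorem exp_div_sinh_antitoneOn : AntitoneOn (fun x => exp x / sinh x) (Set.Ioi 0) := by
  intro x hx y hy hxy
  have hle : exp (y - x) ≥ exp (x - y) := exp_le_exp.2 (by linarith)
  rw [sub_eq_add_neg, sub_eq_add_neg, exp_add, exp_add] at hle
  refine (div_le_div_iff₀ (sinh_pos_iff.2 hy) (sinh_pos_iff.2 hx)).2 ?_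
  rw [sinh_eq, sinh_eq]
  linarith

/-- The bound for solutions of the linearized equation with integrating factor `sinh ^ 2`. -/
theorem abs_le_of_abs_deriv_add_coth_mul_le {b H₀ δ ς : ℝ} {w : ℝ → ℝ} (hb : 2 < b)
    (hH₀ : 0 < H₀) (hδ : 0 ≤ δ) (hw : ∀ H ∈ Set.Icc H₀ ς, DifferentiableAt ℝ w H)
    (hwς : w ς = 0)
    (hbound : ∀ H ∈ Set.Icc H₀ ς,
      |deriv w H + 2 * (cosh H / sinh H) * w H| ≤ δ * exp (-b * H))
    {H : ℝ} (hH : H ∈ Set.Icc H₀ ς) :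
    |w H| ≤ (δ / (4 * (b - 2))) * exp ((2 - b) * H) / sinh H ^ 2 := by
  have hb' : 0 < b - 2 := sub_pos.2 hb
  have hsinh : ∀ x ∈ Set.Icc H₀ ς, 0 < sinh x := fun x hx =>
    sinh_pos_iff.2 (hH₀.trans_le hx.1)
  have hf : ∀ x ∈ Set.Icc H₀ ς, HasDerivAt (fun y => sinh y ^ 2 * w y)
      (sinh x ^ 2 * (deriv w x + 2 * (cosh x / sinh x) * w x)) x := fun x hx => by
    have hne := (hsinh x hx).ne'
    refine (((hasDerivAt_sinh x).pow 2).mul (hw x hx).hasDerivAt).congr_deriv ?_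
    simp only [Pi.pow_apply]
    field_simp
    ring
  have hg : ∀ x ∈ Set.Icc H₀ ς, HasDerivAt (fun y => δ / (4 * (b - 2)) * exp ((2 - b) * y))
      (-(δ / 4 * exp ((2 - b) * x))) x := fun x _ => by
    refine ((((hasDerivAt_id' x).const_mul (2 - b)).exp).const_mul
      (δ / (4 * (b - 2)))).congr_deriv ?_
    field_simp
    ring
  have key := abs_le_of_abs_hasDerivAt_le_neg hf hg (fun x hx => ?_) (by simp [hwς])
    (by positivity) hH
  · rw [abs_mul, abs_of_nonneg (sq_nonneg _)] at key
    rw [le_div_iff₀ (pow_pos (hsinh H hH) 2)]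
    linarith
  · rw [abs_mul, abs_of_nonneg (sq_nonneg _), neg_neg]
    calc sinh x ^ 2 * |deriv w x + 2 * (cosh x / sinh x) * w x|
        ≤ exp (2 * x) / 4 * (δ * exp (-b * x)) := by
          gcongr
          · exact sinh_sq_le_exp_two_mul_div_four (hH₀.le.trans hx.1)
          · exact hbound x hx
      _ = δ / 4 * exp ((2 - b) * x) := by
          rw [show (2 - b) * x = 2 * x + -b * x by ring, exp_add]
          ring

/-- Backward stability of the linearized Riccati equation for the mean curvature
of geodesic spheres in hyperbolic space: if `w(ς) = 0` and
`|w′(H) + 2·(cosh H/sinh H)·w(H)| ≤ δ·e^{−bH}` on `[H₀, ς]` (with `b > 2`,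
`δ ≥ 0`, `0 < H₀ ≤ ς`), then
`|w(H)| ≤ (δ/(4(b−2)))·e^{(2−b)H}/sinh(H)²` on `[H₀, ς]`; in particular
`|w(H)| ≤ C·δ·e^{−bH}` for a constant `C` depending only on `H₀` (and `b`),
not on `δ`, `ς` or `w`. -/
theorem riccati_linearization_backward_stability
    (b : ℝ) (hb : 2 < b) (H₀ : ℝ) (hH₀ : 0 < H₀) :
    ∃ C : ℝ, 0 < C ∧
      ∀ (δ ς : ℝ) (w : ℝ → ℝ), 0 ≤ δ → H₀ ≤ ς →
        (∀ H ∈ Set.Icc H₀ ς, DifferentiableAt ℝ w H) →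
        w ς = 0 →
        (∀ H ∈ Set.Icc H₀ ς,
          |deriv w H + 2 * (Real.cosh H / Real.sinh H) * w H| ≤ δ * Real.exp (-b * H)) →
        ∀ H ∈ Set.Icc H₀ ς,
          |w H| ≤ (δ / (4 * (b - 2))) * Real.exp ((2 - b) * H) / Real.sinh H ^ 2 ∧
          |w H| ≤ C * δ * Real.exp (-b * H) := by
  have hb' : 0 < b - 2 := sub_pos.2 hb
  have hsinh₀ : 0 < Real.sinh H₀ := sinh_pos_iff.2 hH₀
  refine ⟨(exp H₀ / sinh H₀) ^ 2 / (4 * (b - 2)), by positivity, ?_⟩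
  intro δ ς w hδ _ hw hwς hbound H hH
  have h := abs_le_of_abs_deriv_add_coth_mul_le hb hH₀ hδ hw hwς hbound hH
  refine ⟨h, h.trans ?_⟩
  have hpos : 0 < H := hH₀.trans_le hH.1
  have hsinh : 0 < sinh H := sinh_pos_iff.2 hpos
  have hle : exp H / sinh H ≤ exp H₀ / sinh H₀ := exp_div_sinh_antitoneOn hH₀ hpos hH.1
  calc δ / (4 * (b - 2)) * exp ((2 - b) * H) / sinh H ^ 2
      = (exp H / sinh H) ^ 2 / (4 * (b - 2)) * δ * exp (-b * H) := by
        rw [show (2 - b) * H = H + H + -b * H by ring, exp_add, exp_add]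
        ring
    _ ≤ (exp H₀ / sinh H₀) ^ 2 / (4 * (b - 2)) * δ * exp (-b * H) := by gcongr
end
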